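/- arXiv:1503.00163 — 2 statements merged into one kernel-verified Lean document; each statement's English description precedes it below -/
import Mathlib

section
/- Let σ < 1, σ ≠ 0, and let {V_{n,k} : n ≥ 1, 1 ≤ k ≤ n} satisfy the Gibbs-type recursion V_{n,k} = (n - σk) V_{n+1,k} + V_{n+1,k+1}. Then for all integers 1 ≤ k ≤ n and m ≥ 0: ∑_{j=0}^m V_{n+m,k+j} · σ^{-j} 𝒞(m,j;σ,-n+kσ) = V_{n,k}, where 𝒞(m,j;σ,-n+kσ) = (1/j!) ∑_{r=0}^j (-1)^r C(j,r) (n - σ(r+k))_m (with the convention 𝒞(0,0;σ,γ)=1 and 𝒞(m,j;σ,γ)=0 for j > m). -/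
/-- Rising factorial `(x)_n = x (x+1) ⋯ (x+n-1)`, with `(x)_0 = 1`. -/
noncomputable def risingFactorial (x : ℝ) : ℕ → ℝ
  | 0 => 1
  | n + 1 => risingFactorial x n * (x + n)

/-- Non-central generalized factorial coefficient
`𝒞(m,j;σ,-n+kσ) = (1/j!) ∑_{r=0}^j (-1)^r C(j,r) (n - σ(r+k))_m`. -/
noncomputable def ncGenFactCoeff (σ : ℝ) (n k m j : ℕ) : ℝ :=
  (1 / (j.factorial : ℝ)) *
    ∑ r ∈ Finset.range (j + 1),
      (-1 : ℝ) ^ r * (j.choose r : ℝ) * risingFactorial ((n : ℝ) - σ * ((r : ℝ) + k)) m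

theorem ncGen_succ_zero (σ : ℝ) (n k m : ℕ) :
    ncGenFactCoeff σ n k (m + 1) 0
      = ((n : ℝ) + m - σ * k) * ncGenFactCoeff σ n k m 0 := by
  simp [ncGenFactCoeff, risingFactorial]
  ring

theorem ncGen_succ_succ (σ : ℝ) (n k m j : ℕ) :
    ncGenFactCoeff σ n k (m + 1) (j + 1)
      = ((n : ℝ) + m - σ * (k + (j + 1))) * ncGenFactCoeff σ n k m (j + 1)
        + σ * ncGenFactCoeff σ n k m j := by
  have key : ∑ r ∈ Finset.range (j + 1 + 1),
      (-1 : ℝ) ^ r * ((j + 1).choose r : ℝ) *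
        risingFactorial ((n : ℝ) - σ * ((r : ℝ) + k)) (m + 1)
      = ((n : ℝ) + m - σ * (k + (j + 1))) * ∑ r ∈ Finset.range (j + 1 + 1),
      (-1 : ℝ) ^ r * ((j + 1).choose r : ℝ) *
        risingFactorial ((n : ℝ) - σ * ((r : ℝ) + k)) m
      + σ * (j + 1) * ∑ r ∈ Finset.range (j + 1),
      (-1 : ℝ) ^ r * (j.choose r : ℝ) *
        risingFactorial ((n : ℝ) - σ * ((r : ℝ) + k)) m := by
    have ext : ∑ r ∈ Finset.range (j + 1),
      (-1 : ℝ) ^ r * (j.choose r : ℝ) *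
        risingFactorial ((n : ℝ) - σ * ((r : ℝ) + k)) m
        = ∑ r ∈ Finset.range (j + 1 + 1),
      (-1 : ℝ) ^ r * (j.choose r : ℝ) *
        risingFactorial ((n : ℝ) - σ * ((r : ℝ) + k)) m := by
      rw [Finset.sum_range_succ _ (j + 1)]
      simp
    rw [ext, Finset.mul_sum, Finset.mul_sum, ← Finset.sum_add_distrib]
    refine Finset.sum_congr rfl fun r hr => ?_
    have hr' : r ≤ j + 1 := by
      have := Finset.mem_range.mp hr
      omega
    have h := Nat.choose_mul_succ_eq j r
    have h2 : (j.choose r : ℝ) * (j + 1) = ((j + 1).choose r : ℝ) * (j + 1 - r) := by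
      have h3 : ((j.choose r * (j + 1) : ℕ) : ℝ) = (((j + 1).choose r * (j + 1 - r) : ℕ) : ℝ) :=
        congrArg _ h
      rw [Nat.cast_mul, Nat.cast_mul, Nat.cast_sub hr'] at h3
      push_cast at h3
      exact h3
    simp only [risingFactorial]
    linear_combination (-(σ * (-1 : ℝ) ^ r *
      risingFactorial ((n : ℝ) - σ * ((r : ℝ) + k)) m)) * h2
  unfold ncGenFactCoeff
  rw [key, Nat.factorial_succ]
  have hj : (j.factorial : ℝ) ≠ 0 := by positivity
  have hj1 : (j : ℝ) + 1 ≠ 0 := by positivity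
  push_cast
  field_simp

theorem ncGen_eq_zero (σ : ℝ) (n k m : ℕ) :
    ∀ j, m < j → ncGenFactCoeff σ n k m j = 0 := by
  induction m with
  | zero =>
    intro j hj
    have h : ∑ r ∈ Finset.range (j + 1), (-1 : ℝ) ^ r * (j.choose r : ℝ) = 0 := by
      have := add_pow (-1 : ℝ) 1 j
      simp only [one_pow, mul_one] at this
      rw [← this, neg_add_cancel, zero_pow (by omega)]
    simp [ncGenFactCoeff, risingFactorial, h]
  | succ m ih =>
    intro j hj
    obtain _ | j := j
    · omega
    · rw [ncGen_succ_succ, ih _ (by omega), ih _ (by omega)]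
      simp

/-- Let `σ < 1`, `σ ≠ 0`, and let `V` satisfy the Gibbs-type recursion
`V_{n,k} = (n - σk) V_{n+1,k} + V_{n+1,k+1}` for `1 ≤ k ≤ n`. Then for all integers
`1 ≤ k ≤ n` and `m ≥ 0`:
`∑_{j=0}^m V_{n+m,k+j} σ^{-j} 𝒞(m,j;σ,-n+kσ) = V_{n,k}`. -/
theorem gibbs_new_species_distribution_sums_to_one (σ : ℝ) (hσ1 : σ < 1) (hσ0 : σ ≠ 0)
    (V : ℕ → ℕ → ℝ)
    (hrec : ∀ n k : ℕ, 1 ≤ k → k ≤ n →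
      V n k = ((n : ℝ) - σ * k) * V (n + 1) k + V (n + 1) (k + 1))
    (n k m : ℕ) (hk : 1 ≤ k) (hkn : k ≤ n) :
    ∑ j ∈ Finset.range (m + 1),
        V (n + m) (k + j) * σ⁻¹ ^ j * ncGenFactCoeff σ n k m j = V n k := by
  induction m with
  | zero => simp [ncGenFactCoeff, risingFactorial]
  | succ m ih =>
    rw [← ih]
    have e : ∀ j ∈ Finset.range (m + 1),
        V (n + m) (k + j) * σ⁻¹ ^ j * ncGenFactCoeff σ n k m j
        = ((n : ℝ) + m - σ * (k + j)) * V (n + (m + 1)) (k + j) * σ⁻¹ ^ j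
            * ncGenFactCoeff σ n k m j
          + V (n + (m + 1)) (k + (j + 1)) * σ⁻¹ ^ j * ncGenFactCoeff σ n k m j := by
      intro j hj
      have := Finset.mem_range.mp hj
      rw [hrec (n + m) (k + j) (by omega) (by omega)]
      push_cast
      simp only [← add_assoc]
      ring
    rw [Finset.sum_congr rfl e, Finset.sum_add_distrib]
    have e2 : ∑ j ∈ Finset.range (m + 1),
        ((n : ℝ) + m - σ * (k + j)) * V (n + (m + 1)) (k + j) * σ⁻¹ ^ j
            * ncGenFactCoeff σ n k m j
        = ∑ j ∈ Finset.range (m + 1 + 1),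
        ((n : ℝ) + m - σ * (k + j)) * V (n + (m + 1)) (k + j) * σ⁻¹ ^ j
            * ncGenFactCoeff σ n k m j := by
      rw [Finset.sum_range_succ _ (m + 1), ncGen_eq_zero σ n k m (m + 1) (by omega)]
      simp
    rw [e2, Finset.sum_range_succ', Finset.sum_range_succ' _ (m + 1), ncGen_succ_zero,
      add_right_comm, ← Finset.sum_add_distrib]
    congr 1
    · refine Finset.sum_congr rfl fun j _ => ?_
      rw [ncGen_succ_succ]
      push_cast
      rw [pow_succ]
      have : σ⁻¹ * σ = 1 := inv_mul_cancel₀ hσ0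
      linear_combination (V (n + (m + 1)) (k + (j + 1)) * σ⁻¹ ^ j
        * ncGenFactCoeff σ n k m j) * this
    · push_cast
      ring
end

section
/- For γ ∈ (0,1) and integers 1 ≤ k ≤ n, the Gnedin model arises as a mixture of Pitman–Yor processes with σ = -1: ∑_{m=k}^∞ (γ (1-γ)_{m-1} / m!) · ((m-1)!/(m-k)!) / (m+1)_{n-1} = (k-1)! (1-γ)_{k-1} (γ)_{n-k} / ((n-1)! (1+γ)_{n-1}). -/
open Filter Topology

lemma rf_succ (x : ℝ) (n : ℕ) : risingFactorial x (n+1) = risingFactorial x n * (x + n) := rfl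

lemma rf_pos (x : ℝ) (hx : 0 < x) (n : ℕ) : 0 < risingFactorial x n := by
  induction n with
  | zero => simp [risingFactorial]
  | succ n ih => rw [rf_succ]; positivity

lemma rf_fact (m n : ℕ) :
    (m.factorial : ℝ) * risingFactorial ((m:ℝ)+1) n = ((m+n).factorial : ℝ) := by
  induction n with
  | zero => simp [risingFactorial]
  | succ n ih =>
    rw [rf_succ, ← mul_assoc, ih, ← add_assoc, Nat.factorial_succ]; push_cast; ring

lemma rf_shift (x : ℝ) (n : ℕ) :
    x * risingFactorial (1 + x) n = risingFactorial x n * (x + n) := by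
  induction n with
  | zero => simp [risingFactorial]
  | succ n ih =>
    rw [rf_succ, ← mul_assoc, ih, rf_succ]; push_cast; ring

noncomputable def gterm (γ : ℝ) (n k m : ℕ) : ℝ :=
  if k + 1 ≤ m then
    γ * risingFactorial (1 - γ) (m - 1) * ((m-1).factorial : ℝ) /
      (((m - (k+1)).factorial : ℝ) * ((m+n).factorial : ℝ)) else 0

lemma gterm_rec (γ : ℝ) (n k m : ℕ) :
    gterm γ (n+1) (k+1) m = gterm γ n k m - (n + k + 2) * gterm γ (n+1) k m := by
  unfold gterm
  rcases lt_trichotomy m (k+1) with h | h | h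
  · rw [if_neg (by omega), if_neg (by omega), if_neg (by omega)]; simp
  · subst h
    rw [if_neg (by omega), if_pos le_rfl, if_pos le_rfl, ← add_assoc, Nat.factorial_succ (k+1+n)]
    have := Nat.factorial_pos (k+1+n)
    push_cast
    field_simp
    ring
  · obtain ⟨j, rfl⟩ : ∃ j, m = k + 1 + 1 + j := ⟨m - (k+2), by omega⟩
    rw [if_pos (by omega), if_pos (by omega), if_pos (by omega), ← add_assoc,
      Nat.factorial_succ (k+1+1+j+n)]
    rw [show k+1+1+j-(k+1+1) = j by omega, show k+1+1+j-(k+1) = j+1 by omega,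
      Nat.factorial_succ j]
    have := Nat.factorial_pos (k+1+1+j+n)
    have := Nat.factorial_pos j
    push_cast
    field_simp
    ring

lemma u_bound (γ : ℝ) (h0 : 0 < γ) (h1 : γ < 1) (j : ℕ) :
    risingFactorial (1 - γ) j / (j.factorial : ℝ) *
      (1 + γ * ∑ i ∈ Finset.range j, 1 / ((i:ℝ) + 1)) ≤ 1 := by
  induction j with
  | zero => simp [risingFactorial]
  | succ j ih =>
    refine le_trans ?_ ih
    rw [rf_succ, Nat.factorial_succ, Finset.sum_range_succ]
    have hr := rf_pos (1-γ) (by linarith) j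
    have hf : (0:ℝ) < j.factorial := by exact_mod_cast Nat.factorial_pos j
    have hS : 0 ≤ ∑ i ∈ Finset.range j, 1 / ((i:ℝ) + 1) :=
      Finset.sum_nonneg fun i _ => by positivity
    generalize (∑ i ∈ Finset.range j, 1 / ((i:ℝ) + 1)) = S at *
    have hx : 0 < γ / ((j:ℝ)+1) := by positivity
    have e : risingFactorial (1 - γ) j * (1 - γ + j) / (((j+1) * j.factorial : ℕ) : ℝ) *
        (1 + γ * (S + 1 / ((j:ℝ) + 1))) = risingFactorial (1 - γ) j / (j.factorial : ℝ) *
        ((1 - γ / ((j:ℝ)+1)) * (1 + γ * S + γ / ((j:ℝ)+1))) := by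
      push_cast
      field_simp
      ring
    rw [e]
    apply mul_le_mul_of_nonneg_left _ (by positivity)
    have := mul_nonneg hx.le (mul_nonneg h0.le hS)
    nlinarith

lemma u_tendsto (γ : ℝ) (h0 : 0 < γ) (h1 : γ < 1) :
    Tendsto (fun j : ℕ => risingFactorial (1 - γ) j / (j.factorial : ℝ)) atTop (𝓝 0) := by
  have hH := Real.tendsto_sum_range_one_div_nat_succ_atTop
  have h2 : Tendsto (fun j : ℕ => (1 + γ * ∑ i ∈ Finset.range j, 1 / ((i:ℝ) + 1))⁻¹)
      atTop (𝓝 0) :=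
    tendsto_inv_atTop_zero.comp (tendsto_atTop_add_const_left _ _ (hH.const_mul_atTop h0))
  refine squeeze_zero (fun j => ?_) (fun j => ?_) h2
  · have := rf_pos (1-γ) (by linarith) j
    positivity
  · have hS : 0 ≤ ∑ i ∈ Finset.range j, 1 / ((i:ℝ) + 1) :=
      Finset.sum_nonneg fun i _ => by positivity
    rw [← one_div, le_div_iff₀ (by positivity)]
    exact u_bound γ h0 h1 j

lemma base (γ : ℝ) (h0 : 0 < γ) (h1 : γ < 1) (n : ℕ) :
    HasSum (gterm γ n 0) (γ / ((n + γ) * (n.factorial : ℝ))) := by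
  rw [← hasSum_nat_add_iff' 1]
  have hz : ∑ i ∈ Finset.range 1, gterm γ n 0 i = 0 := by simp [gterm]
  rw [hz, sub_zero]
  have hpos : ∀ j, 0 < risingFactorial (1-γ) j := fun j => rf_pos (1-γ) (by linarith) j
  have hnn : ∀ j, 0 ≤ gterm γ n 0 (j+1) := by
    intro j
    have := hpos j
    rw [gterm, if_pos (by omega), Nat.add_sub_cancel]
    positivity
  rw [hasSum_iff_tendsto_nat_of_nonneg hnn]
  have hps : ∀ N, ∑ j ∈ Finset.range N, gterm γ n 0 (j+1) =
      γ / ((n + γ) * (n.factorial : ℝ)) -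
        γ / (n + γ) * (risingFactorial (1-γ) N / ((N+n).factorial : ℝ)) := by
    intro N
    induction N with
    | zero => simp [risingFactorial]; field_simp; ring
    | succ N ih =>
      rw [Finset.sum_range_succ, ih, gterm, if_pos (by omega), rf_succ,
        show N + 1 + n = N + n + 1 by ring, Nat.factorial_succ (N+n)]
      simp only [zero_add, Nat.add_sub_cancel]
      have := Nat.factorial_pos (N+n)
      have := Nat.factorial_pos N
      have : (n:ℝ) + γ ≠ 0 := by positivity
      push_cast
      field_simp
      ring
  have hu : Tendsto (fun N : ℕ => risingFactorial (1-γ) N / ((N+n).factorial : ℝ))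
      atTop (𝓝 0) := by
    refine squeeze_zero (fun j => ?_) (fun j => ?_) (u_tendsto γ h0 h1)
    · have := hpos j
      positivity
    · have := hpos j
      apply div_le_div_of_nonneg_left this.le (by positivity)
      exact_mod_cast Nat.factorial_le (by omega)
  simp_rw [hps]
  simpa using (hu.const_mul (γ / (n + γ))).const_sub (γ / ((n + γ) * (n.factorial : ℝ)))

lemma main_sum (γ : ℝ) (h0 : 0 < γ) (h1 : γ < 1) (k : ℕ) : ∀ b : ℕ,
    HasSum (gterm γ (k+b) k) ((k.factorial : ℝ) * risingFactorial (1 - γ) k *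
      risingFactorial γ b / (((k+b).factorial : ℝ) * risingFactorial (1 + γ) (k+b))) := by
  induction k with
  | zero =>
    intro b
    rw [zero_add]
    convert base γ h0 h1 b using 1
    have h := rf_shift γ b
    have hp := rf_pos (1+γ) (by linarith) b
    have hb : (b:ℝ) + γ ≠ 0 := by positivity
    simp only [risingFactorial, Nat.factorial_zero, Nat.cast_one, one_mul]
    field_simp
    linarith
  | succ k ih =>
    intro b
    have hA := ih b
    have hB := (ih (b+1)).mul_left (((k+b:ℕ):ℝ) + k + 2)
    have hC := hA.sub hB
    rw [show k + 1 + b = k + b + 1 by ring]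
    rw [← add_assoc] at hC
    have hfun : gterm γ (k+b+1) (k+1) = fun m => gterm γ (k + b) k m -
        (((k+b:ℕ):ℝ) + k + 2) * gterm γ (k + b + 1) k m := by
      funext m
      exact gterm_rec γ (k+b) k m
    rw [hfun]
    convert hC using 1
    · rfl
    · have hp := rf_pos (1+γ) (by linarith) (k+b)
      have hb : (1:ℝ) + γ + (k+b:ℕ) ≠ 0 := by positivity
      push_cast at hb
      simp only [rf_succ, Nat.factorial_succ]
      push_cast
      field_simp
      ring

/-- For `γ ∈ (0,1)` and integers `1 ≤ k ≤ n`, the Gnedin model arises as a mixture of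
Pitman–Yor processes with `σ = -1` and mixing distribution `π(m) = γ(1-γ)_{m-1}/m!`:
`∑_{m=k}^∞ (γ(1-γ)_{m-1}/m!) ((m-1)!/(m-k)!) / (m+1)_{n-1}
  = (k-1)! (1-γ)_{k-1} (γ)_{n-k} / ((n-1)! (1+γ)_{n-1})`. -/
theorem gnedin_as_py_mixture (γ : ℝ) (hγ0 : 0 < γ) (hγ1 : γ < 1)
    (n k : ℕ) (hk : 1 ≤ k) (hkn : k ≤ n) :
    (∑' m : ℕ, if k ≤ m then
        γ * risingFactorial (1 - γ) (m - 1) / (m.factorial : ℝ) *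
          (((m - 1).factorial : ℝ) / ((m - k).factorial : ℝ)) /
            risingFactorial ((m : ℝ) + 1) (n - 1)
      else 0) =
      ((k - 1).factorial : ℝ) * risingFactorial (1 - γ) (k - 1) *
          risingFactorial γ (n - k) /
        (((n - 1).factorial : ℝ) * risingFactorial (1 + γ) (n - 1)) := by
  obtain ⟨k, rfl⟩ : ∃ a, k = a + 1 := ⟨k - 1, by omega⟩
  obtain ⟨b, rfl⟩ : ∃ b, n = k + b + 1 := ⟨n - (k + 1), by omega⟩
  have h := (main_sum γ hγ0 hγ1 k b).tsum_eq
  rw [show k + b + 1 - (k + 1) = b by omega]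
  simp only [Nat.add_sub_cancel]
  rw [← h]
  congr 1
  funext m
  rw [gterm]
  split_ifs with hm
  · rw [← rf_fact m (k+b)]
    have hp := rf_pos ((m:ℝ)+1) (by positivity) (k+b)
    field_simp
  · rfl
end
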